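/- Let H, K be bialgebras over a commutative ring R with a Hopf pairing ⟨·,·⟩ : H × K → R, and let C ⊆ K be an R-submodule with ε(C) = 0 and Δ(C) ⊆ C⊗K + K⊗C (a coideal). Then the orthogonal C^⊥ ⊆ H is a unital subalgebra: 1 ∈ C^⊥ and x₁·x₂ ∈ C^⊥ for all x₁, x₂ ∈ C^⊥. (This is one of the orthogonality relations of Subsections 2.2 and 3.6: the orthogonal of a quantum-subgroup-type coideal is a quantum-homogeneous-space-type subalgebra.) -/

import Mathlib

open TensorProduct

/-- The factorwise extension of a pairing `p : H × K → R` to tensor squares: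
`pairT p (x₁ ⊗ x₂) (y₁ ⊗ y₂) = p x₁ y₁ * p x₂ y₂`. -/
noncomputable def pairT {R H K : Type*} [CommRing R]
    [AddCommGroup H] [Module R H] [AddCommGroup K] [Module R K]
    (p : H →ₗ[R] K →ₗ[R] R) :
    H ⊗[R] H →ₗ[R] Module.Dual R (K ⊗[R] K) :=
  (TensorProduct.dualDistrib R K K).comp (TensorProduct.map p p)

/-- If `x₁` and `x₂` are orthogonal to `C`, then `x₁ ⊗ x₂` is orthogonal to `C ⊗ K + K ⊗ C`. -/
theorem pairT_tmul_eq_zero {R H K : Type*} [CommRing R]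
    [AddCommGroup H] [Module R H] [AddCommGroup K] [Module R K]
    (p : H →ₗ[R] K →ₗ[R] R) (C : Submodule R K) {x₁ x₂ : H}
    (h₁ : ∀ c ∈ C, p x₁ c = 0) (h₂ : ∀ c ∈ C, p x₂ c = 0) {t : K ⊗[R] K}
    (ht : t ∈ LinearMap.range (TensorProduct.map C.subtype (LinearMap.id (R := R) (M := K))) ⊔
      LinearMap.range (TensorProduct.map (LinearMap.id (R := R) (M := K)) C.subtype)) :
    pairT p (x₁ ⊗ₜ[R] x₂) t = 0 := by
  obtain ⟨_, ⟨u, rfl⟩, _, ⟨v, rfl⟩, rfl⟩ := Submodule.mem_sup.mp ht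
  have hu : (pairT p (x₁ ⊗ₜ[R] x₂)).comp
      (TensorProduct.map C.subtype (LinearMap.id (R := R) (M := K))) = 0 := by
    ext a b
    simp [pairT, h₁ a a.2]
  have hv : (pairT p (x₁ ⊗ₜ[R] x₂)).comp
      (TensorProduct.map (LinearMap.id (R := R) (M := K)) C.subtype) = 0 := by
    ext a b
    simp [pairT, h₂ b b.2]
  rw [map_add, ← LinearMap.comp_apply, ← LinearMap.comp_apply, hu, hv]
  simp

/-- Let `H, K` be bialgebras over a commutative ring `R` with a Hopf pairing
`p`, and `C ⊆ K` a submodule with `ε(C) = 0` and `Δ(C) ⊆ C⊗K + K⊗C` (a coideal).  Then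
`C^⊥ ⊆ H` is a unital subalgebra: `1 ∈ C^⊥` and `C^⊥` is closed under multiplication. -/
theorem stmt_9 {R H K : Type*} [CommRing R] [Ring H] [Ring K]
    [Bialgebra R H] [Bialgebra R K]
    (p : H →ₗ[R] K →ₗ[R] R)
    (hp1 : ∀ (x : H) (y₁ y₂ : K),
      p x (y₁ * y₂) = pairT p (Coalgebra.comul (R := R) x) (y₁ ⊗ₜ[R] y₂))
    (hp2 : ∀ (x₁ x₂ : H) (y : K),
      p (x₁ * x₂) y = pairT p (x₁ ⊗ₜ[R] x₂) (Coalgebra.comul (R := R) y))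
    (hp3 : ∀ x : H, p x 1 = Coalgebra.counit (R := R) x)
    (hp4 : ∀ y : K, p 1 y = Coalgebra.counit (R := R) y)
    (C : Submodule R K)
    (hCε : ∀ c ∈ C, Coalgebra.counit (R := R) c = (0 : R))
    (hCΔ : ∀ c ∈ C, Coalgebra.comul (R := R) c ∈
      LinearMap.range (TensorProduct.map C.subtype (LinearMap.id (R := R) (M := K))) ⊔
      LinearMap.range (TensorProduct.map (LinearMap.id (R := R) (M := K)) C.subtype)) :
    (∀ c ∈ C, p 1 c = 0) ∧
    (∀ x₁ x₂ : H, (∀ c ∈ C, p x₁ c = 0) → (∀ c ∈ C, p x₂ c = 0) →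
      ∀ c ∈ C, p (x₁ * x₂) c = 0) := by
  refine ⟨fun c hc => (hp4 c).trans (hCε c hc), fun x₁ x₂ h₁ h₂ c hc => ?_⟩
  rw [hp2]
  exact pairT_tmul_eq_zero p C h₁ h₂ (hCΔ c hc)
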